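/- For all sufficiently large integers r the following holds: for every integer n ≥ 1 such that n - 1 is a multiple of ⌈r/2 + s + 1/2⌉, there exists a tree T on n vertices whose number of r-matchings is at least (e^{-6/r^2} · α_r)^{n-1}, where s > 0 is the unique real with r/2 + s = (s+1)·log(s+1) and α_r = e^{1/(s+1)}. (Such a tree is obtained from the star K_{1,(n-1)/⌈r/2+s+1/2⌉} by subdividing each edge ⌈r/2 + s + 1/2⌉ - 1 times.) -/

import Mathlib

open SimpleGraph Filter

/-- The distance between two edges `e, f` of a graph `G`: the minimum distance between
a vertex incident to `e` and a vertex incident to `f`. -/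
noncomputable def edgeDist {V : Type*} (G : SimpleGraph V) (e f : Sym2 V) : ℕ :=
  sInf {d : ℕ | ∃ u ∈ e, ∃ w ∈ f, G.dist u w = d}

/-- `M` is an `r`-matching in `G`: a set of edges of `G` any two distinct members of which
are at distance at least `r`. -/
def IsRMatching {V : Type*} (G : SimpleGraph V) (r : ℕ) (M : Finset (Sym2 V)) : Prop :=
  (∀ e ∈ M, e ∈ G.edgeSet) ∧ ∀ e ∈ M, ∀ f ∈ M, e ≠ f → r ≤ edgeDist G e f

/-- The number of `r`-matchings in `G`. -/
noncomputable def numRMatchings {V : Type*} (G : SimpleGraph V) (r : ℕ) : ℕ :=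
  Nat.card {M : Finset (Sym2 V) // IsRMatching G r M}

/-- `s_r(P_n)`: the number of `r`-matchings in the path on `n` vertices. -/
noncomputable def pathMatchings (r n : ℕ) : ℕ :=
  numRMatchings (SimpleGraph.pathGraph n) r


theorem an_S {r s : ℝ} (hr : 13 ≤ r) (hs : 0 < s) (h : r / 2 + s = (s + 1) * Real.log (s + 1)) :
    3 ≤ s + 1 ∧ 2 * r ≤ (s+1)^2 := by
  have h1 := Real.log_le_sub_one_of_pos (show 0 < s + 1 by linarith)
  have h2 := Real.log_le_sub_one_of_pos (show 0 < (s + 1)/4 by linarith)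
  have h4 : Real.log 4 < 1.39 := by
    have : (4:ℝ) = 2 ^ 2 := by norm_num
    rw [this, Real.log_pow]
    have := Real.log_two_lt_d9
    push_cast; linarith
  rw [Real.log_div (by linarith) (by norm_num)] at h2
  have a : 3 ≤ s + 1 := by
    by_contra hc
    push Not at hc
    nlinarith
  refine ⟨a, ?_⟩
  have : (s+1) * Real.log (s+1) ≤ (s+1) * ((s+1)/4 + 0.39) := by
    apply mul_le_mul_of_nonneg_left _ (by linarith); linarith
  nlinarith

theorem an_log {w : ℝ} (hw : 0 ≤ w) : w - w^2 ≤ Real.log (1 + w) := by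
  have := Real.one_sub_inv_le_log_of_pos (show 0 < 1 + w by linarith)
  have h2 : w - w^2 ≤ 1 - (1+w)⁻¹ := by
    have : 1 - (1+w)⁻¹ = w / (1+w) := by field_simp; ring
    rw [this, le_div_iff₀ (by linarith)]
    nlinarith [mul_nonneg hw (sq_nonneg w)]
  linarith

theorem an_lone {r s K : ℝ} (hr : 13 ≤ r) (hs : 0 < s) (h : r / 2 + s = (s + 1) * Real.log (s + 1))
    (hk1 : r / 2 + s + 1/2 ≤ K) (hk2 : K < r / 2 + s + 1/2 + 1) :
    Real.exp (K * (-6 / r^2 + 1 / (s+1))) ≤ 1 + K - r / 2 := by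
  obtain ⟨h3, h2⟩ := an_S hr hs h
  obtain ⟨y, hy⟩ : ∃ y, y = K - (r/2 + s + 1/2) := ⟨_, rfl⟩
  obtain ⟨S, hS⟩ : ∃ S, S = s + 1 := ⟨_, rfl⟩
  rw [← hS] at h h2 h3 ⊢
  have hS0 : 0 < S := by linarith
  have hrK : r / 2 ≤ K := by linarith
  have hK0 : 0 ≤ K := by linarith
  have hw : 0 ≤ (1/2 + y)/S := by apply div_nonneg <;> linarith
  have e1 : 1 + K - r/2 = S * (1 + (1/2+y)/S) := by field_simp; linarith
  rw [← Real.le_log_iff_exp_le (by linarith), e1, Real.log_mul hS0.ne' (by positivity)]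
  have := an_log hw
  have hK : K / S = Real.log S + (1/2+y)/S := by
    field_simp; linarith
  have e2 : K * (-6 / r^2 + 1 / S) = Real.log S + (1/2+y)/S - 6 * K / r^2 := by
    rw [← hK]; ring
  rw [e2]
  have e3 : ((1/2+y)/S)^2 ≤ 6 * K / r^2 := by
    rw [div_pow, div_le_div_iff₀ (by positivity) (by positivity)]
    have : (1/2+y)^2 ≤ 9/4 := by nlinarith
    have : (1/2+y)^2 * r^2 ≤ 9/4 * r^2 := by gcongr
    have : 6 * (r/2) * (2*r) ≤ 6 * K * S^2 := by
      apply mul_le_mul _ h2 (by linarith) (by linarith); linarith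
    nlinarith
  linarith

theorem an_pair {r s K : ℝ} (hr : 13 ≤ r) (hs : 0 < s) (h : r / 2 + s = (s + 1) * Real.log (s + 1))
    (hk1 : r / 2 + s + 1/2 ≤ K) (hk2 : K < r / 2 + s + 1/2 + 1) {N : ℝ} (hN : K - r/2 + 1/2 ≤ N) :
    Real.exp (K * (-6 / r^2 + 1 / (s+1))) ^ 2 ≤ N * (N + 1) - 3 := by
  obtain ⟨h3, h2⟩ := an_S hr hs h
  obtain ⟨y, hy⟩ : ∃ y, y = K - (r/2 + s + 1/2) := ⟨_, rfl⟩
  obtain ⟨S, hS⟩ : ∃ S, S = s + 1 := ⟨_, rfl⟩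
  rw [← hS] at h h2 h3 ⊢
  have hS0 : 0 < S := by linarith
  have hrK : r / 2 ≤ K := by linarith
  have hK0 : 0 ≤ K := by linarith
  have hN2 : (S + y) * (S + y + 1) - 3 ≤ N * (N + 1) - 3 := by
    have : S + y ≤ N := by linarith
    have : (S + y) * (S + y + 1) ≤ N * (N+1) := by gcongr <;> linarith
    linarith
  refine le_trans ?_ hN2
  have hw : 0 ≤ (1 + 2*y)/S - 3/S^2 := by
    rw [sub_nonneg, div_le_div_iff₀ (by positivity) (by positivity)]
    nlinarith
  have hw2 : (1 + 2*y)/S - 3/S^2 ≤ 3/S := by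
    have : (1+2*y)/S ≤ 3/S := by gcongr; linarith
    have : 0 ≤ 3/S^2 := by positivity
    linarith
  have e1 : S^2 * (1 + ((1+2*y)/S - 3/S^2)) ≤ (S + y) * (S + y + 1) - 3 := by
    have : S^2 * (1 + ((1+2*y)/S - 3/S^2)) = S^2 + (1+2*y)*S - 3 := by field_simp; ring
    nlinarith
  refine le_trans ?_ e1
  rw [← Real.exp_nat_mul, ← Real.le_log_iff_exp_le (by positivity), Real.log_mul (by positivity) (by positivity), Real.log_pow]
  have := an_log hw
  have hK : K / S = Real.log S + (1/2+y)/S := by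
    field_simp; linarith
  have e2 : K * (-6 / r^2 + 1 / S) = Real.log S + (1/2+y)/S - 6 * K / r^2 := by
    rw [← hK]; ring
  rw [e2]
  have e3 : ((1 + 2*y)/S - 3/S^2)^2 ≤ 9 / S^2 := by
    calc _ ≤ (3/S)^2 := by gcongr
      _ = _ := by rw [div_pow]; norm_num
  have e4 : 12 / S^2 ≤ 2 * (6 * K / r^2) := by
    rw [← mul_div_assoc, div_le_div_iff₀ (by positivity) (by positivity)]
    have : 2 * (6 * (r/2)) * (2*r) ≤ 2 * (6 * K) * S^2 := by
      apply mul_le_mul _ h2 (by linarith) (by linarith); linarith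
    nlinarith
  have e5 : 12 / S^2 = 9 / S^2 + 3/S^2 := by ring
  have e6 : 2 * ((1/2+y)/S) = (1+2*y)/S := by ring
  push_cast
  linarith

theorem le_edgeDist {V : Type*} (G : SimpleGraph V) (e f : Sym2 V) (r : ℕ)
    (h : ∀ u ∈ e, ∀ w ∈ f, r ≤ G.dist u w) : r ≤ edgeDist G e f := by
  unfold edgeDist
  apply le_csInf
  · exact ⟨_, e.out.1, e.out_fst_mem, f.out.1, f.out_fst_mem, rfl⟩
  · rintro d ⟨u, hu, w, hw, rfl⟩
    exact h u hu w hw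

theorem edgeDist_le {V : Type*} (G : SimpleGraph V) (e f : Sym2 V) {u w : V} (hu : u ∈ e)
    (hw : w ∈ f) : edgeDist G e f ≤ G.dist u w :=
  Nat.sInf_le ⟨u, hu, w, hw, rfl⟩

theorem iso_dist_le {V W : Type*} {G : SimpleGraph V} {H : SimpleGraph W} (φ : G ≃g H)
    (hH : H.Connected) (u w : V) : G.dist u w ≤ H.dist (φ u) (φ w) := by
  obtain ⟨p, hp⟩ := hH.exists_walk_length_eq_dist (φ u) (φ w)
  have := dist_le (p.map φ.symm.toHom)
  rw [Walk.length_map, hp] at this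
  simpa using this

theorem iso_num_le {V W : Type*} [Finite W] {G : SimpleGraph V} {H : SimpleGraph W} (φ : G ≃g H)
    (hH : H.Connected) (r : ℕ) : numRMatchings G r ≤ numRMatchings H r := by
  classical
  unfold numRMatchings
  have : Finite (Sym2 W) := Quot.finite _
  have hinj : Function.Injective (Sym2.map φ) := Sym2.map.injective φ.injective
  apply Nat.card_le_card_of_injective
    (fun M : {M : Finset (Sym2 V) // IsRMatching G r M} =>
      (⟨M.1.image (Sym2.map φ), by
        obtain ⟨M, h1, h2⟩ := M
        constructor
        · intro e he
          obtain ⟨e, he', rfl⟩ := Finset.mem_image.1 he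
          have := h1 e he'
          induction e with | _ a b => simpa [φ.map_adj_iff] using this
        · intro e he f hf hne
          obtain ⟨e, he', rfl⟩ := Finset.mem_image.1 he
          obtain ⟨f, hf', rfl⟩ := Finset.mem_image.1 hf
          have hne' : e ≠ f := fun h => hne (by rw [h])
          apply le_edgeDist
          intro u hu w hw
          obtain ⟨u, hu', rfl⟩ := Sym2.mem_map.1 hu
          obtain ⟨w, hw', rfl⟩ := Sym2.mem_map.1 hw
          exact (h2 e he' f hf' hne').trans ((edgeDist_le G e f hu' hw').trans
            (iso_dist_le φ hH u w))⟩ : {M : Finset (Sym2 W) // IsRMatching H r M}))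
  intro M M' h
  apply Subtype.ext
  exact Finset.image_injective hinj (congrArg Subtype.val h)

/-- Legs: `p` pairs of legs and `ε` lone legs. -/
abbrev Leg (p ε : ℕ) := (Fin p × Bool) ⊕ Fin ε

abbrev Vtx (p ε k : ℕ) := Option (Leg p ε × Fin k)

def par {p ε k : ℕ} : Leg p ε × Fin k → Vtx p ε k
  | (.inl (a, b), ⟨0, h⟩) => if b then some (.inl (a, false), ⟨0, h⟩) else none
  | (.inr _, ⟨0, _⟩) => none
  | (l, ⟨j + 1, h⟩) => some (l, ⟨j, by omega⟩)

def off {p ε : ℕ} : Leg p ε → ℕ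
  | .inl (_, true) => 1
  | _ => 0

def blk {p ε : ℕ} : Leg p ε → Fin p ⊕ Fin ε
  | .inl (a, _) => .inl a
  | .inr u => .inr u

def Dp {p ε k : ℕ} (v : Leg p ε × Fin k) : ℕ := v.2 + off v.1

def dep {p ε k : ℕ} : Vtx p ε k → ℕ
  | none => 0
  | some v => Dp v + 1

theorem dep_par {p ε k : ℕ} (v : Leg p ε × Fin k) : dep (par v) = Dp v := by
  rcases v with ⟨(⟨a, (_ | _)⟩ | u), ⟨(_ | j), h⟩⟩ <;> simp [par, dep, Dp, off]

def tr (p ε k : ℕ) : SimpleGraph (Vtx p ε k) :=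
  SimpleGraph.fromRel (fun x y => ∃ v, x = some v ∧ y = par v)

theorem par_ne {p ε k : ℕ} (v : Leg p ε × Fin k) : some v ≠ par v := by
  intro h
  have := congrArg dep h
  rw [dep_par] at this
  simp [dep] at this

theorem tr_adj {p ε k : ℕ} (v : Leg p ε × Fin k) : (tr p ε k).Adj (some v) (par v) := by
  rw [tr, fromRel_adj]
  exact ⟨par_ne v, Or.inl ⟨v, rfl, rfl⟩⟩

theorem tr_adj_iff {p ε k : ℕ} {x y : Vtx p ε k} (h : (tr p ε k).Adj x y) :
    ∃ v, (x = some v ∧ y = par v) ∨ (y = some v ∧ x = par v) := by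
  rw [tr, fromRel_adj] at h
  rcases h.2 with ⟨v, h⟩ | ⟨v, h⟩
  · exact ⟨v, Or.inl h⟩
  · exact ⟨v, Or.inr h⟩

def ed {p ε k : ℕ} (v : Leg p ε × Fin k) : Sym2 (Vtx p ε k) := s(some v, par v)

theorem ed_inj {p ε k : ℕ} : Function.Injective (ed (p := p) (ε := ε) (k := k)) := by
  intro v w h
  rcases Sym2.eq_iff.1 h with h | h
  · exact Option.some.inj h.1
  · have h1 := congrArg dep h.1
    have h2 := congrArg dep h.2
    rw [dep_par] at h1 h2
    simp [dep] at h1 h2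
    omega

theorem tr_connected (p ε k : ℕ) : (tr p ε k).Connected := by
  have key : ∀ d : ℕ, ∀ x : Vtx p ε k, dep x = d → (tr p ε k).Reachable x none := by
    intro d
    induction d with
    | zero =>
      intro x hx
      cases x with
      | none => exact Reachable.refl _
      | some v => simp [dep] at hx
    | succ d ih =>
      intro x hx
      cases x with
      | none => exact Reachable.refl _
      | some v =>
        refine (tr_adj v).reachable.trans (ih _ ?_)
        rw [dep_par]
        simpa [dep] using hx
  have : Nonempty (Vtx p ε k) := ⟨none⟩
  exact Connected.mk fun x y => (key _ x rfl).trans (key _ y rfl).symm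

theorem tr_edgeSet (p ε k : ℕ) : (tr p ε k).edgeSet = Set.range ed := by
  ext e
  induction e with | _ x y =>
  rw [mem_edgeSet]
  constructor
  · intro h
    obtain ⟨v, ⟨rfl, rfl⟩ | ⟨rfl, rfl⟩⟩ := tr_adj_iff h
    · exact ⟨v, rfl⟩
    · exact ⟨v, Sym2.eq_swap⟩
  · rintro ⟨v, h⟩
    rw [← mem_edgeSet, ← h]
    exact tr_adj v

theorem tr_isTree (p ε k : ℕ) : (tr p ε k).IsTree := by
  rw [isTree_iff_connected_and_card]
  refine ⟨tr_connected p ε k, ?_⟩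
  rw [tr_edgeSet, Nat.card_range_of_injective ed_inj]
  simp

theorem lip {p ε k : ℕ} (f : Vtx p ε k → ℤ) (hf : ∀ v, |f (some v) - f (par v)| ≤ 1)
    (x y : Vtx p ε k) : f x - f y ≤ (tr p ε k).dist x y := by
  obtain ⟨q, hq⟩ := (tr_connected p ε k).exists_walk_length_eq_dist x y
  rw [← hq]
  clear hq
  induction q with
  | nil => simp
  | cons h q ih =>
    rw [Walk.length_cons]
    push_cast
    obtain ⟨v, ⟨rfl, rfl⟩ | ⟨rfl, rfl⟩⟩ := tr_adj_iff h
    · have := abs_le.1 (hf v); linarith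
    · have := abs_le.1 (hf v); linarith

def fB {p ε k : ℕ} (β : Fin p ⊕ Fin ε) : Vtx p ε k → ℤ
  | none => 0
  | some v => if blk v.1 = β then Dp v + 1 else - (Dp v + 1)

theorem fB_par {p ε k : ℕ} (β : Fin p ⊕ Fin ε) (v : Leg p ε × Fin k) :
    fB β (par v) = if blk v.1 = β then (Dp v : ℤ) else - Dp v := by
  rcases v with ⟨(⟨a, (_ | _)⟩ | u), ⟨(_ | j), h⟩⟩ <;> simp [par, fB, Dp, off, blk]

theorem dist_cross {p ε k : ℕ} (v w : Leg p ε × Fin k) (h : blk v.1 ≠ blk w.1) :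
    Dp v + Dp w ≤ edgeDist (tr p ε k) (ed v) (ed w) := by
  apply le_edgeDist
  intro x hx y hy
  have hl := lip (fB (blk v.1)) (fun u => by
    rw [fB_par]; simp only [fB]; split_ifs <;> simp) x y
  have h1 : (Dp v : ℤ) ≤ fB (blk v.1) x := by
    rcases Sym2.mem_iff.1 hx with rfl | rfl
    · simp [fB]
    · simp [fB_par]
  have h2 : fB (blk v.1) y ≤ - (Dp w : ℤ) := by
    rcases Sym2.mem_iff.1 hy with rfl | rfl
    · simp [fB, h.symm]
    · simp [fB_par, h.symm]
  omega

def gB {p ε k : ℕ} (a : Fin p) : Vtx p ε k → ℤ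
  | some (.inl (b, true), j) => if b = a then - ((j : ℕ) + 1 : ℤ) else 0
  | some (.inl (b, false), j) => if b = a then ((j : ℕ) : ℤ) else 0
  | _ => 0

theorem dist_in {p ε k : ℕ} (a : Fin p) (i j : Fin k) (r : ℕ) (h : r + 1 ≤ (i : ℕ) + j) :
    r ≤ edgeDist (tr p ε k) (ed (.inl (a, false), i)) (ed (.inl (a, true), j)) := by
  apply le_edgeDist
  intro x hx y hy
  have hl := lip (gB (p := p) (ε := ε) (k := k) a) (fun v => by
    rcases v with ⟨(⟨a, (_ | _)⟩ | u), ⟨(_ | j), h⟩⟩ <;> simp [par, gB]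
    <;> split_ifs <;> simp) x y
  have h1 : (i : ℤ) - 1 ≤ gB a x := by
    rcases Sym2.mem_iff.1 hx with rfl | rfl
    · simp [gB]
    · rcases i with ⟨(_ | i), hi⟩ <;> simp [par, gB]
  have h2 : gB a y ≤ - (j : ℤ) := by
    rcases Sym2.mem_iff.1 hy with rfl | rfl
    · simp [gB]
    · rcases j with ⟨(_ | j), hj⟩ <;> simp [par, gB]
  omega

theorem edgeDist_comm {V : Type*} (G : SimpleGraph V) (e f : Sym2 V) :
    edgeDist G e f = edgeDist G f e := by
  apply le_antisymm
  · exact le_edgeDist _ _ _ _ fun u hu w hw => by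
      rw [dist_comm]; exact edgeDist_le _ _ _ hw hu
  · exact le_edgeDist _ _ _ _ fun u hu w hw => by
      rw [dist_comm]; exact edgeDist_le _ _ _ hw hu

/-- Admissible configurations of a pair of legs. -/
abbrev PC (h k : ℕ) := {x : Option (Fin k) × Option (Fin k) //
  (∀ i, x.1 = some i → h ≤ i) ∧ (∀ j, x.2 = some j → h ≤ j + 1) ∧
  ∀ i j, x.1 = some i → x.2 = some j → 2 * h + 1 ≤ (i : ℕ) + j}

/-- Admissible configurations of a lone leg. -/
abbrev LC (h k : ℕ) := {x : Option (Fin k) // ∀ i, x = some i → h ≤ i}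

theorem card_LC (h k : ℕ) (hk : h ≤ k) : k - h + 1 ≤ Fintype.card (LC h k) := by
  have := Fintype.card_le_of_injective
    (fun x : Option (Fin (k - h)) => (⟨x.map (fun i : Fin (k - h) => ⟨i + h, by omega⟩), by
      rintro i hi
      obtain ⟨a, _, rfl⟩ := Option.map_eq_some_iff.1 hi
      simp⟩ : LC h k)) (by
      intro x y hxy
      have := congrArg Subtype.val hxy
      refine Option.map_injective ?_ this
      intro a b hab
      simpa [Fin.ext_iff] using hab)
  simpa using this

theorem card_PC (h c : ℕ) (hh : 1 ≤ h) (hc : 2 ≤ c) :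
    (c + 1) * (c + 2) - 3 ≤ Fintype.card (PC h (c + h)) := by
  let bad : Finset (Option (Fin c) × Option (Fin (c + 1))) :=
    {(some ⟨0, by omega⟩, some ⟨0, by omega⟩), (some ⟨0, by omega⟩, some ⟨1, by omega⟩),
      (some ⟨1, by omega⟩, some ⟨0, by omega⟩)}
  have hb : bad.card ≤ 3 := Finset.card_le_three
  have h1 := Finset.le_card_sdiff bad Finset.univ
  have h2 := Fintype.card_le_of_injective
    (fun x : ↥(Finset.univ \ bad) => (⟨(x.1.1.map (fun i : Fin c => ⟨i + h, by omega⟩),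
        x.1.2.map (fun i : Fin (c + 1) => ⟨i + h - 1, by omega⟩)), by
      obtain ⟨⟨x1, x2⟩, hx⟩ := x
      refine ⟨?_, ?_, ?_⟩
      · rintro i hi
        obtain ⟨a, _, rfl⟩ := Option.map_eq_some_iff.1 hi
        simp
      · rintro i hi
        obtain ⟨a, _, rfl⟩ := Option.map_eq_some_iff.1 hi
        simp; omega
      · rintro i j hi hj
        obtain ⟨a, ha, rfl⟩ := Option.map_eq_some_iff.1 hi
        obtain ⟨b, hb, rfl⟩ := Option.map_eq_some_iff.1 hj
        simp only at ha hb
        subst ha hb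
        have hx' := (Finset.mem_sdiff.1 hx).2
        simp only [bad, Finset.mem_insert, Finset.mem_singleton, Prod.mk.injEq,
          Option.some.injEq, Fin.ext_iff] at hx'
        simp only
        omega⟩ : PC h (c + h))) (by
      intro x y hxy
      have := congrArg Subtype.val hxy
      simp only [Prod.mk.injEq] at this
      apply Subtype.ext
      refine Prod.ext (Option.map_injective ?_ this.1) (Option.map_injective ?_ this.2)
      · intro a b hab
        simpa [Fin.ext_iff] using hab
      · intro a b hab
        simp [Fin.ext_iff] at hab
        ext; omega)
  rw [Fintype.card_coe] at h2
  simp only [Finset.card_univ, Fintype.card_prod, Fintype.card_option, Fintype.card_fin] at h1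
  have h3 : (c+1) * (c+2) - 3 ≤ (c+1)*(c+1+1) - bad.card := by
    have : (c+1) * (c+2) = (c+1)*(c+1+1) := by ring
    omega
  exact h3.trans (h1.trans h2)

/-- The choice function of a configuration. -/
def ch {p ε k h h' : ℕ} (X : (Fin p → PC h k) × (Fin ε → LC h' k)) : Leg p ε → Option (Fin k)
  | .inl (a, false) => (X.1 a).1.1
  | .inl (a, true) => (X.1 a).1.2
  | .inr u => (X.2 u).1

theorem ch_inj {p ε k h h' : ℕ} :
    Function.Injective (ch (p := p) (ε := ε) (k := k) (h := h) (h' := h')) := by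
  rintro ⟨X, X'⟩ ⟨Y, Y'⟩ hxy
  ext1
  · funext a
    exact Subtype.ext (Prod.ext (congrFun hxy (.inl (a, false))) (congrFun hxy (.inl (a, true))))
  · funext u
    exact Subtype.ext (congrFun hxy (.inr u))

open Classical in
noncomputable def mset {p ε k : ℕ} (φ : Leg p ε → Option (Fin k)) : Finset (Sym2 (Vtx p ε k)) :=
  (Finset.univ.filter (fun v : Leg p ε × Fin k => φ v.1 = some v.2)).image ed

theorem mt_inj {p ε k : ℕ} : Function.Injective (mset (p := p) (ε := ε) (k := k)) := by
  classical
  intro φ ψ h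
  have := Finset.image_injective ed_inj h
  funext l
  apply Option.ext
  intro j
  have := congrArg (fun s => (l, j) ∈ s) this
  simpa using this

theorem num_ge (p ε k r : ℕ) (hε : ε ≤ 1) :
    Fintype.card (PC ((r + 1) / 2) k) ^ p * Fintype.card (LC (r / 2) k) ^ ε ≤
      numRMatchings (tr p ε k) r := by
  classical
  have hcard : Nat.card ((Fin p → PC ((r + 1) / 2) k) × (Fin ε → LC (r / 2) k)) =
      Fintype.card (PC ((r + 1) / 2) k) ^ p * Fintype.card (LC (r / 2) k) ^ ε := by
    rw [Nat.card_eq_fintype_card]; simp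
  rw [← hcard, numRMatchings]
  apply Nat.card_le_card_of_injective
    (fun X => (⟨mset (ch X), ?_⟩ : {M : Finset (Sym2 (Vtx p ε k)) // IsRMatching (tr p ε k) r M}))
  · intro X Y hXY
    exact ch_inj (mt_inj (congrArg Subtype.val hXY))
  · constructor
    · intro e he
      obtain ⟨v, _, rfl⟩ := Finset.mem_image.1 he
      rw [tr_edgeSet]; exact ⟨v, rfl⟩
    · intro e he f hf hne
      obtain ⟨⟨l, i⟩, hv, rfl⟩ := Finset.mem_image.1 he
      obtain ⟨⟨l', j⟩, hw, rfl⟩ := Finset.mem_image.1 hf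
      simp only [Finset.mem_filter, Finset.mem_univ, true_and] at hv hw
      by_cases hb : blk l = blk l'
      · rcases l with ⟨a, (_ | _)⟩ | u <;> rcases l' with ⟨a', (_ | _)⟩ | u' <;>
          simp only [blk, Sum.inl.injEq, Sum.inr.injEq, reduceCtorEq] at hb
        · subst hb; rw [hv] at hw; cases hw; exact absurd rfl hne
        · subst hb
          have := (X.1 a).2.2.2 i j hv hw
          exact dist_in a i j r (by omega)
        · subst hb
          have := (X.1 a).2.2.2 j i hw hv
          rw [edgeDist_comm]
          exact dist_in a j i r (by omega)
        · subst hb; rw [hv] at hw; cases hw; exact absurd rfl hne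
        · subst hb; rw [hv] at hw; cases hw; exact absurd rfl hne
      · refine le_trans ?_ (dist_cross (l, i) (l', j) hb)
        have key : ∀ (l : Leg p ε) (i : Fin k), ch X l = some i →
            r / 2 ≤ Dp (l, i) ∧ ((∃ a, l = .inl a) → (r + 1) / 2 ≤ Dp (l, i)) := by
          intro l i hv
          rcases l with ⟨a, (_ | _)⟩ | u
          · have := (X.1 a).2.1 i hv
            simp [Dp, off]; omega
          · have := (X.1 a).2.2.1 i hv
            simp [Dp, off]; omega
          · have := (X.2 u).2 i hv
            simp [Dp, off]; omega
        have k1 := key l i hv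
        have k2 := key l' j hw
        rcases l with a | u
        · have := k1.2 ⟨a, rfl⟩
          omega
        · rcases l' with a' | u'
          · have := k2.2 ⟨a', rfl⟩
            omega
          · exact absurd (congrArg blk (congrArg Sum.inr (Fin.ext (by omega)))) hb

/-- For all sufficiently large `r`: for every `n ≥ 1` with `n - 1` a multiple of
`⌈r/2 + s + 1/2⌉`, there is a tree on `n` vertices with at least
`(e^{-6/r²} · α_r)^{n-1}` `r`-matchings, where `s > 0` is the unique real with
`r/2 + s = (s+1)·log(s+1)` and `α_r = e^{1/(s+1)}`. -/
theorem stmt18 :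
    ∃ R : ℕ, ∀ r : ℕ, R ≤ r → ∀ s : ℝ, 0 < s →
      (r : ℝ) / 2 + s = (s + 1) * Real.log (s + 1) →
      ∀ n : ℕ, 1 ≤ n → (⌈(r : ℝ) / 2 + s + 1 / 2⌉₊ ∣ n - 1) →
        ∃ G : SimpleGraph (Fin n), G.IsTree ∧
          (Real.exp (-6 / (r : ℝ) ^ 2) * Real.exp (1 / (s + 1))) ^ (n - 1) ≤
            (numRMatchings G r : ℝ) := by
  refine ⟨13, fun r hr s hs heq n hn hdvd => ?_⟩
  obtain ⟨k, hk⟩ : ∃ k, k = ⌈(r : ℝ) / 2 + s + 1 / 2⌉₊ := ⟨_, rfl⟩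
  rw [← hk] at hdvd
  have hr' : (13 : ℝ) ≤ r := by exact_mod_cast hr
  have hk1 : (r : ℝ) / 2 + s + 1 / 2 ≤ k := hk ▸ Nat.le_ceil _
  have hk2 : (k : ℝ) < (r : ℝ) / 2 + s + 1 / 2 + 1 := hk ▸ Nat.ceil_lt_add_one (by positivity)
  obtain ⟨m, hm⟩ := hdvd
  have hpm : m = 2 * (m / 2) + m % 2 := by omega
  have hε : m % 2 ≤ 1 := by omega
  obtain ⟨p, hp⟩ : ∃ p, p = m / 2 := ⟨_, rfl⟩
  obtain ⟨ε, hε'⟩ : ∃ ε, ε = m % 2 := ⟨_, rfl⟩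
  rw [← hp, ← hε'] at hpm
  rw [← hε'] at hε
  have hc : Fintype.card (Vtx p ε k) = n := by
    simp only [Fintype.card_option, Fintype.card_prod, Fintype.card_sum, Fintype.card_fin,
      Fintype.card_bool]
    have : n = k * m + 1 := by omega
    rw [this, hpm]; ring
  have hφ := (tr p ε k).overFinIso hc
  have hT : ((tr p ε k).overFin hc).IsTree := hφ.isTree_iff.1 (tr_isTree p ε k)
  refine ⟨(tr p ε k).overFin hc, hT, ?_⟩
  have hnum := (num_ge p ε k r hε).trans (iso_num_le hφ hT.1 r)
  refine le_trans ?_ (Nat.cast_le.2 hnum)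
  have hS := (an_S hr' hs heq).1
  obtain ⟨h, hh⟩ : ∃ h, h = (r + 1) / 2 := ⟨_, rfl⟩
  have hh1 : (h : ℝ) ≤ r / 2 + 1 / 2 := by
    have : 2 * h ≤ r + 1 := by omega
    have : (2 * h : ℝ) ≤ r + 1 := by exact_mod_cast this
    linarith
  have hkh : h + 2 ≤ k := by
    have : (h + 2 : ℝ) ≤ k := by linarith
    exact_mod_cast this
  obtain ⟨c, hc'⟩ : ∃ c, k = c + h := ⟨k - h, by omega⟩
  have hkc : (k : ℝ) = c + h := by exact_mod_cast hc'
  have hr2 : ((r / 2 : ℕ) : ℝ) ≤ r / 2 := Nat.cast_div_le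
  set E := Real.exp ((k : ℝ) * (-6 / (r : ℝ)^2 + 1 / (s+1))) with hE
  have hpair : E ^ 2 ≤ (Fintype.card (PC ((r + 1) / 2) k) : ℝ) := by
    have h1 := card_PC h c (by omega) (by omega)
    rw [← hc', hh] at h1
    have h1' : (c + 1) * (c + 2) ≤ Fintype.card (PC ((r + 1) / 2) k) + 3 := by omega
    have h2 : (((c + 1) * (c + 2) : ℕ) : ℝ) ≤ ((Fintype.card (PC ((r + 1) / 2) k) + 3 : ℕ) : ℝ) :=
      Nat.cast_le.2 h1'
    push_cast at h2
    have h3 := an_pair hr' hs heq hk1 hk2 (N := (c : ℝ) + 1) (by linarith)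
    rw [← hE] at h3
    linarith
  have hlone : E ≤ (Fintype.card (LC (r / 2) k) : ℝ) := by
    have h1 := card_LC (r / 2) k (by omega)
    have h1' : k + 1 ≤ Fintype.card (LC (r / 2) k) + r / 2 := by omega
    have h2 : ((k + 1 : ℕ) : ℝ) ≤ ((Fintype.card (LC (r / 2) k) + r / 2 : ℕ) : ℝ) :=
      Nat.cast_le.2 h1'
    rw [Nat.cast_add, Nat.cast_add] at h2
    have h3 := an_lone hr' hs heq hk1 hk2
    rw [← hE] at h3
    push_cast at h2 hr2 ⊢
    linarith
  have hE0 : 0 ≤ E := (Real.exp_pos _).le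
  have hL : (Real.exp (-6 / (r : ℝ) ^ 2) * Real.exp (1 / (s + 1))) ^ (n - 1) = (E ^ 2) ^ p * E ^ ε := by
    rw [hm, pow_mul, ← Real.exp_add, ← Real.exp_nat_mul, ← hE, hpm, pow_add, pow_mul]
  rw [hL, Nat.cast_mul, Nat.cast_pow, Nat.cast_pow]
  gcongr
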